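/- Let P be an irreducible tridiagonal sign pattern with 0-diagonal of order n ≥ 4, with edge signs s k = P k (k+1) · P (k+1) k for k = 0,…,n−2. Suppose there exists an index l with l + 2 ≤ n − 2 such that (s l, s (l+1), s (l+2)) = (+, −, +) or (s l, s (l+1), s (l+2)) = (−, +, −); this says exactly that the principal subpattern of P on the four consecutive indices l, l+1, l+2, l+3 is (up to equivalence) the 4×4 tridiagonal pattern P₄ with consecutive edge signs +,−,+, or its negation P₄₋ with consecutive edge signs −,+,−. Then P does not require a unique inertia: there exist B₁, B₂ ∈ Q(P) with In(B₁) ≠ In(B₂). -/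

import Mathlib

open Polynomial Matrix

def QClass {n : ℕ} (P : Matrix (Fin n) (Fin n) SignType) (B : Matrix (Fin n) (Fin n) ℝ) : Prop :=
  ∀ i j, SignType.sign (B i j) = P i j

noncomputable def charRoots {n : ℕ} (B : Matrix (Fin n) (Fin n) ℝ) : Multiset ℂ :=
  ((B.charpoly).map (algebraMap ℝ ℂ)).roots

noncomputable def inertia {n : ℕ} (B : Matrix (Fin n) (Fin n) ℝ) : ℕ × ℕ × ℕ :=
  (((charRoots B).filter (fun z => 0 < z.re)).card,
   ((charRoots B).filter (fun z => z.re < 0)).card,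
   ((charRoots B).filter (fun z => z.re = 0)).card)

section PathPolynomial

/-- The polynomial `q` with `p = X ^ (k % 2) * q(X ^ 2)`, where `p` is the characteristic polynomial
of a zero-diagonal tridiagonal matrix on the indices `a, …, a + k - 1` whose edge products are
`c`. -/
noncomputable def pathPoly (c : ℕ → ℝ) (a : ℕ) : ℕ → ℝ[X]
  | 0 => 1
  | 1 => 1
  | k + 2 => (if Even k then X else 1) * pathPoly c a (k + 1) - C (c (a + k)) * pathPoly c a k

lemma pathPoly_add_two (c : ℕ → ℝ) (a k : ℕ) :
    pathPoly c a (k + 2) =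
      (if Even k then X else 1) * pathPoly c a (k + 1) - C (c (a + k)) * pathPoly c a k := by
  rw [pathPoly]

lemma pathPoly_congr {c c' : ℕ → ℝ} {a : ℕ} :
    ∀ k, (∀ j, a ≤ j → j + 1 < a + k → c j = c' j) → pathPoly c a k = pathPoly c' a k
  | 0, _ => by simp [pathPoly]
  | 1, _ => by simp [pathPoly]
  | k + 2, h => by
    rw [pathPoly_add_two, pathPoly_add_two, pathPoly_congr (k + 1) fun j h₁ h₂ => h j h₁ (by lia),
      pathPoly_congr k fun j h₁ h₂ => h j h₁ (by lia), h (a + k) (by lia) (by lia)]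

lemma pathPoly_add_two_left (c : ℕ → ℝ) (a : ℕ) :
    ∀ k, pathPoly c a (k + 2) =
      (if Even k then X else 1) * pathPoly c (a + 1) (k + 1) - C (c a) * pathPoly c (a + 2) k
  | 0 => by simp [pathPoly]
  | 1 => by simp [pathPoly]; ring
  | k + 2 => by
    have h₁ := pathPoly_add_two_left c a k
    have h₂ := pathPoly_add_two_left c a (k + 1)
    have h₃ := pathPoly_add_two c (a + 1) (k + 1)
    have h₄ := pathPoly_add_two c (a + 2) k
    have h₅ := pathPoly_add_two c a (k + 2)
    rw [show a + 1 + (k + 1) = a + (k + 2) by ring] at h₃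
    rw [show a + 2 + k = a + (k + 2) by ring] at h₄
    rw [show k + 1 + 1 = k + 2 by ring, show k + 1 + 2 = k + 3 by ring] at *
    rw [show k + 2 + 1 = k + 3 by ring] at *
    rw [h₅, h₂, h₁, h₃, h₄, if_congr (show Even (k + 2) ↔ Even k by simp [parity_simps]) rfl rfl]
    ring

lemma pathPoly_monic_natDegree (c : ℕ → ℝ) (a : ℕ) :
    ∀ k, (pathPoly c a k).Monic ∧ (pathPoly c a k).natDegree = k / 2
  | 0 => by simp [pathPoly]
  | 1 => by simp [pathPoly]
  | k + 2 => by
    obtain ⟨m₁, d₁⟩ := pathPoly_monic_natDegree c a (k + 1)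
    obtain ⟨m₀, d₀⟩ := pathPoly_monic_natDegree c a k
    have hm : ((if Even k then X else 1) * pathPoly c a (k + 1)).Monic := by
      split_ifs
      · exact monic_X.mul m₁
      · simpa using m₁
    have hd : ((if Even k then X else 1) * pathPoly c a (k + 1)).natDegree = (k + 2) / 2 := by
      split_ifs with hk
      · rw [natDegree_X_mul m₁.ne_zero, d₁]
        obtain ⟨r, rfl⟩ := hk
        lia
      · rw [one_mul, d₁]
        obtain ⟨r, rfl⟩ := Nat.not_even_iff_odd.1 hk
        lia
    have hlt : (C (c (a + k)) * pathPoly c a k).degree <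
        ((if Even k then X else 1) * pathPoly c a (k + 1)).degree := by
      rw [← smul_eq_C_mul]
      refine (degree_smul_le _ _).trans_lt ?_
      rw [degree_eq_natDegree m₀.ne_zero, degree_eq_natDegree hm.ne_zero, d₀, hd]
      exact_mod_cast (by lia)
    rw [pathPoly_add_two]
    refine ⟨hm.sub_of_left hlt, ?_⟩
    rw [natDegree_eq_of_degree_eq (degree_sub_eq_left_of_degree_lt hlt), hd]

lemma pathPoly_eval_zero_mul_pos {c c' : ℕ → ℝ} (h : ∀ j, 0 < c j * c' j) (a m : ℕ) :
    0 < (pathPoly c a (2 * m)).eval 0 * (pathPoly c' a (2 * m)).eval 0 := by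
  induction m with
  | zero => simp [pathPoly]
  | succ m ih =>
    rw [mul_add, mul_one, pathPoly_add_two, pathPoly_add_two]
    simp only [even_two_mul, if_true, eval_sub, eval_mul, eval_X, zero_mul, eval_C, zero_sub]
    nlinarith [mul_pos (h (a + 2 * m)) ih]

end PathPolynomial

section CharacteristicPolynomial

lemma det_tridiagonal_add_two {R : Type*} [CommRing R] (f : ℕ → ℕ → R)
    (hf : ∀ i j, i + 1 < j ∨ j + 1 < i → f i j = 0) (a n : ℕ) :
    (Matrix.of fun i j : Fin (n + 2) => f (a + i) (a + j)).det =
      f a a * (Matrix.of fun i j : Fin (n + 1) => f (a + 1 + i) (a + 1 + j)).det -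
        f a (a + 1) * f (a + 1) a *
          (Matrix.of fun i j : Fin n => f (a + 2 + i) (a + 2 + j)).det := by
  rw [det_succ_row_zero, Fin.sum_univ_succ, Fin.sum_univ_succ, Finset.sum_eq_zero, add_zero]
  · have h₁ : (Matrix.of fun i j : Fin (n + 2) => f (a + i) (a + j)).submatrix Fin.succ
        (Fin.succAbove 0) = Matrix.of fun i j : Fin (n + 1) => f (a + 1 + i) (a + 1 + j) := by
      ext i j
      simp only [submatrix_apply, of_apply, Fin.succAbove_zero, Fin.val_succ]
      ring_nf
    have h₂ : ((Matrix.of fun i j : Fin (n + 2) => f (a + i) (a + j)).submatrix Fin.succ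
        (Fin.succAbove (Fin.succ 0))).det = f (a + 1) a *
          (Matrix.of fun i j : Fin n => f (a + 2 + i) (a + 2 + j)).det := by
      rw [det_succ_column_zero, Fin.sum_univ_succ, Finset.sum_eq_zero, add_zero]
      · have : ((Matrix.of fun i j : Fin (n + 2) => f (a + i) (a + j)).submatrix Fin.succ
            (Fin.succAbove (Fin.succ 0))).submatrix (Fin.succAbove 0) Fin.succ =
              Matrix.of fun i j : Fin n => f (a + 2 + i) (a + 2 + j) := by
          ext i j
          simp only [submatrix_apply, of_apply, Fin.succAbove_zero, Fin.val_succ,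
            Fin.succ_succAbove_succ]
          ring_nf
        rw [this]
        simp [Fin.succAbove]
      · intro i _
        simp only [submatrix_apply, of_apply]
        rw [hf _ _ (Or.inr (by simp [Fin.succAbove]))]
        ring
    rw [h₁, h₂]
    simp
    ring
  · intro i _
    simp only [of_apply]
    rw [hf _ _ (Or.inl (by simp))]
    ring

lemma det_tridiagonal_eq_pathPoly (f : ℕ → ℕ → ℝ[X]) (c : ℕ → ℝ)
    (hf : ∀ i j, i + 1 < j ∨ j + 1 < i → f i j = 0) (hd : ∀ i, f i i = X)
    (hc : ∀ i, f i (i + 1) * f (i + 1) i = C (c i)) :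
    ∀ n a, (Matrix.of fun i j : Fin n => f (a + i) (a + j)).det =
      X ^ (n % 2) * (pathPoly c a n).comp (X ^ 2)
  | 0, a => by simp [pathPoly]
  | 1, a => by simp [pathPoly, hd]
  | n + 2, a => by
    rw [det_tridiagonal_add_two f hf, hd, hc, det_tridiagonal_eq_pathPoly f c hf hd hc (n + 1),
      det_tridiagonal_eq_pathPoly f c hf hd hc n, pathPoly_add_two_left]
    rcases Nat.even_or_odd n with h | h
    · rw [if_pos h, Nat.add_mod_right, Nat.even_iff.1 h, Nat.odd_iff.1 h.add_one]
      simp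
      ring
    · rw [if_neg (Nat.not_even_iff_odd.2 h), Nat.add_mod_right, Nat.odd_iff.1 h,
        Nat.even_iff.1 h.add_one]
      simp
      ring

lemma charpoly_tridiagonal_eq_pathPoly (b : ℕ → ℕ → ℝ) (c : ℕ → ℝ)
    (hb : ∀ i j, ¬ (i + 1 = j ∨ j + 1 = i) → b i j = 0)
    (hc : ∀ i, b i (i + 1) * b (i + 1) i = c i) (n : ℕ) :
    (Matrix.of fun i j : Fin n => b i j).charpoly =
      X ^ (n % 2) * (pathPoly c 0 n).comp (X ^ 2) := by
  rw [← det_tridiagonal_eq_pathPoly (fun i j => (if i = j then X else 0) - C (b i j)) c]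
  · rw [Matrix.charpoly]
    congr 1
    ext1 i j
    simp [charmatrix_apply, diagonal_apply, Fin.ext_iff]
  · intro i j h
    rw [if_neg (by lia), hb i j (by lia)]
    simp
  · intro i
    rw [hb i i (by lia)]
    simp
  · intro i
    rw [← hc]
    simp

end CharacteristicPolynomial

section Alternation

/-- `F` does not vanish at `0` and changes sign at least `M` times on `[0, ∞)`. -/
def AlternatesOnNonneg (F : ℝ[X]) (M : ℕ) : Prop :=
  ∃ t : ℕ → ℝ, t 0 = 0 ∧ StrictMono t ∧ ∀ j ≤ M, 0 < (-1) ^ j * F.eval (t j) * F.eval 0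

variable {F : ℝ[X]} {M : ℕ}

lemma AlternatesOnNonneg.neg (h : AlternatesOnNonneg F M) : AlternatesOnNonneg (-F) M := by
  obtain ⟨t, h₀, ht, h⟩ := h
  exact ⟨t, h₀, ht, fun j hj => by simpa using h j hj⟩

lemma eventually_pos_of_sub_mul {u v e : ℝ} (h : 0 < u * e) :
    ∀ᶠ c in nhds (0 : ℝ), 0 < (u - c * v) * e := by
  have : ContinuousAt (fun c : ℝ => (u - c * v) * e) 0 := by fun_prop
  exact this.eventually_const_lt (by simpa using h)

lemma AlternatesOnNonneg.eventually_sub (h : AlternatesOnNonneg F M) (G : ℝ[X]) :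
    ∀ᶠ c in nhds (0 : ℝ), AlternatesOnNonneg (F - C c * G) M := by
  obtain ⟨t, h₀, ht, h⟩ := h
  have key : ∀ᶠ c in nhds (0 : ℝ), ∀ j ∈ Finset.range (M + 1),
      0 < (-1) ^ j * (F - C c * G).eval (t j) * (F - C c * G).eval 0 := by
    rw [Filter.eventually_all_finset]
    intro j hj
    have hc : ContinuousAt
        (fun c : ℝ => (-1) ^ j * (F - C c * G).eval (t j) * (F - C c * G).eval 0) 0 := by
      simp only [eval_sub, eval_mul, eval_C]
      fun_prop
    exact hc.eventually_const_lt (by simpa using h j (by simpa [Nat.lt_succ_iff] using hj))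
  filter_upwards [key] with c hc
  exact ⟨t, h₀, ht, fun j hj => hc j (by simpa [Nat.lt_succ_iff] using hj)⟩

lemma AlternatesOnNonneg.eventually_X_mul_sub (h : AlternatesOnNonneg F M) (G : ℝ[X]) :
    ∀ᶠ c in nhds (0 : ℝ), c * G.eval 0 * F.eval 0 < 0 →
      AlternatesOnNonneg (X * F - C c * G) M := by
  obtain ⟨t, h₀, ht, h⟩ := h
  have key : ∀ᶠ c in nhds (0 : ℝ), ∀ j ∈ Finset.Icc 1 M,
      0 < (t j * F.eval (t j) - c * G.eval (t j)) * ((-1) ^ j * F.eval 0) := by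
    rw [Filter.eventually_all_finset]
    intro j hj
    rw [Finset.mem_Icc] at hj
    have htj : 0 < t j := h₀ ▸ ht (show 0 < j by lia)
    exact eventually_pos_of_sub_mul (by nlinarith [mul_pos htj (h j hj.2)])
  filter_upwards [key] with c hc hsign
  refine ⟨t, h₀, ht, fun j hj => ?_⟩
  have hG : c * G.eval 0 ≠ 0 := fun h' => by simp [h'] at hsign
  rcases Nat.eq_zero_or_pos j with rfl | hj₀
  · simpa [h₀] using hG
  · have h₁ := hc j (Finset.mem_Icc.2 ⟨hj₀, hj⟩)
    have hF : 0 < F.eval 0 ^ 2 := by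
      have : F.eval 0 ≠ 0 := fun h' => by simp [h'] at hsign
      positivity
    simp only [eval_sub, eval_mul, eval_X, eval_C, zero_mul, zero_sub]
    have h₂ : 0 < (-1) ^ j * (t j * F.eval (t j) - c * G.eval (t j)) * (-(c * G.eval 0)) *
        F.eval 0 ^ 2 := by
      nlinarith [mul_pos h₁ (neg_pos.2 hsign)]
    exact pos_of_mul_pos_left h₂ hF.le

lemma AlternatesOnNonneg.eventually_X_mul_sub_succ (h : AlternatesOnNonneg F M) (G : ℝ[X]) :
    ∀ᶠ c in nhds (0 : ℝ), 0 < c * G.eval 0 * F.eval 0 →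
      AlternatesOnNonneg (X * F - C c * G) (M + 1) := by
  obtain ⟨t, h₀, ht, h⟩ := h
  obtain ⟨δ, hδ₀, hδ₁, hδ⟩ : ∃ δ, 0 < δ ∧ δ < t 1 ∧ 0 < F.eval δ * F.eval 0 := by
    have h₁ : ∀ᶠ x in nhds (0 : ℝ), 0 < F.eval x * F.eval 0 := by
      have : ContinuousAt (fun x => F.eval x * F.eval 0) 0 := by fun_prop
      exact this.eventually_const_lt (by simpa [h₀] using h 0 (Nat.zero_le _))
    have h₂ : ∀ᶠ x in nhdsWithin (0 : ℝ) (Set.Ioi 0), x < t 1 :=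
      (eventually_lt_nhds (h₀ ▸ ht Nat.zero_lt_one)).filter_mono nhdsWithin_le_nhds
    obtain ⟨δ, ⟨h₃, h₄⟩, h₅⟩ :=
      ((h₁.filter_mono nhdsWithin_le_nhds).and h₂ |>.and self_mem_nhdsWithin).exists
    exact ⟨δ, h₅, h₄, h₃⟩
  let τ : ℕ → ℝ := fun j => if j = 0 then δ else t j
  have hτ : StrictMono τ := by
    refine strictMono_nat_of_lt_succ fun j => ?_
    rcases Nat.eq_zero_or_pos j with rfl | hj
    · simpa [τ] using hδ₁
    · simpa [τ, hj.ne'] using ht (Nat.lt_succ_self j)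
  have hτ₀ : ∀ j, 0 < τ j := fun j => hδ₀.trans_le (by simpa [τ] using hτ.monotone j.zero_le)
  have key : ∀ᶠ c in nhds (0 : ℝ), ∀ j ∈ Finset.range (M + 1),
      0 < (τ j * F.eval (τ j) - c * G.eval (τ j)) * ((-1) ^ j * F.eval 0) := by
    rw [Filter.eventually_all_finset]
    intro j hj
    refine eventually_pos_of_sub_mul ?_
    have : 0 < (-1) ^ j * F.eval (τ j) * F.eval 0 := by
      rcases Nat.eq_zero_or_pos j with rfl | hj₀
      · simpa [τ] using hδ
      · simpa [τ, hj₀.ne'] using h j (by simpa [Nat.lt_succ_iff] using hj)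
    nlinarith [mul_pos (hτ₀ j) this]
  filter_upwards [key] with c hc hsign
  refine ⟨fun j => if j = 0 then 0 else τ (j - 1), by simp, ?_, ?_⟩
  · refine strictMono_nat_of_lt_succ fun j => ?_
    rcases j with _ | j
    · simpa using hτ₀ 0
    · simpa using hτ (Nat.lt_succ_self j)
  · have hG : c * G.eval 0 ≠ 0 := fun h' => by simp [h'] at hsign
    rintro (_ | j) hj
    · simpa using hG
    · have h₁ := hc j (by simpa using hj)
      have hF : 0 < F.eval 0 ^ 2 := by
        have : F.eval 0 ≠ 0 := fun h' => by simp [h'] at hsign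
        positivity
      simp only [eval_sub, eval_mul, eval_X, eval_C, zero_mul, zero_sub, Nat.succ_ne_zero,
        if_false, Nat.add_sub_cancel, pow_succ]
      have h₂ : 0 < (-1) ^ j * -1 * (τ j * F.eval (τ j) - c * G.eval (τ j)) *
          (-(c * G.eval 0)) * F.eval 0 ^ 2 := by
        nlinarith [mul_pos h₁ hsign]
      exact pos_of_mul_pos_left h₂ hF.le

lemma AlternatesOnNonneg.exists_roots (h : AlternatesOnNonneg F M) :
    ∃ r : Fin M → ℝ, Function.Injective r ∧ ∀ i, 0 < r i ∧ F.eval (r i) = 0 := by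
  obtain ⟨t, h₀, ht, h⟩ := h
  have key : ∀ i : Fin M, ∃ x ∈ Set.Ioo (t i) (t (i + 1)), F.eval x = 0 := by
    intro i
    have hlt := ht (Nat.lt_succ_self i)
    have h₁ := h i i.2.le
    have h₂ := h (i + 1) i.2
    have hprod : F.eval (t i) * F.eval (t (i + 1)) < 0 := by
      have h₃ := mul_pos h₁ h₂
      have h₄ : ((-1 : ℝ) ^ (i : ℕ)) * (-1) ^ (i : ℕ) = 1 := by rw [← mul_pow]; simp
      rw [pow_succ] at h₃
      by_contra! hcon
      have h₅ : 0 ≤ F.eval (t i) * F.eval (t (i + 1)) * (F.eval 0) ^ 2 := by positivity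
      have h₆ : (-1 : ℝ) ^ (i : ℕ) * F.eval (t i) * F.eval 0 *
          ((-1) ^ (i : ℕ) * -1 * F.eval (t (i + 1)) * F.eval 0) =
          -(((-1 : ℝ) ^ (i : ℕ) * (-1) ^ (i : ℕ)) *
            (F.eval (t i) * F.eval (t (i + 1)) * (F.eval 0) ^ 2)) := by ring
      rw [h₆, h₄] at h₃
      linarith
    rcases mul_neg_iff.1 hprod with ⟨hp, hn⟩ | ⟨hn, hp⟩
    · exact intermediate_value_Ioo' hlt.le F.continuousOn ⟨hn, hp⟩
    · exact intermediate_value_Ioo hlt.le F.continuousOn ⟨hn, hp⟩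
  choose r hr hr₀ using key
  have hr_mono : StrictMono r := fun i j hij =>
    (hr i).2.trans_le ((ht.monotone (Nat.succ_le_of_lt hij)).trans (hr j).1.le)
  refine ⟨r, hr_mono.injective, fun i => ⟨?_, hr₀ i⟩⟩
  exact (h₀ ▸ ht.monotone (Nat.zero_le (i : ℕ))).trans_lt (hr i).1

end Alternation

section Contrast

lemma exists_nonreal_root_of_norm_eval_lt {H : ℂ[X]} (hm : H.Monic) {w : ℂ}
    (h : ‖H.eval w‖ < |w.im| ^ H.natDegree) : ∃ z : ℂ, z.im ≠ 0 ∧ H.eval z = 0 := by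
  by_contra! hreal
  have hs := IsAlgClosed.splits H
  have hnorm : ∀ m : Multiset ℂ, ‖m.prod‖ = (m.map norm).prod :=
    map_multiset_prod (normHom : ℂ →*₀ ℝ)
  rw [hs.eval_eq_prod_roots_of_monic hm, hs.natDegree_eq_card_roots, ← Multiset.prod_replicate,
    ← Multiset.map_const', hnorm, Multiset.map_map] at h
  refine h.not_ge (Multiset.prod_map_le_prod_map₀ _ _ (fun _ _ => abs_nonneg _) fun z hz => ?_)
  have hz₀ : z.im = 0 := by
    by_contra hne
    exact hreal z hne (isRoot_of_mem_roots hz)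
  simpa [hz₀] using Complex.abs_im_le_norm (w - z)

/-- The polynomial `F₁` has a non-real root and at least `M` positive roots, while `F₂` has at least
`m - M` negative roots, for some `M`; the roots are required to be robust under perturbations,
and the values at `0` have the same sign. -/
def Contrast (F₁ F₂ : ℝ[X]) (m : ℕ) : Prop :=
  (∃ z : ℂ, z.im ≠ 0 ∧ aeval z F₁ = 0) ∧ 0 < F₁.eval 0 * F₂.eval 0 ∧
    ∃ M N, M + N = m ∧ AlternatesOnNonneg F₁ M ∧ AlternatesOnNonneg (F₂.comp (-X)) N

lemma eventually_exists_nonreal_root {E F G : ℝ[X]} {d : ℕ}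
    (hm : ∀ c, (E * F - C c * G).Monic ∧ (E * F - C c * G).natDegree = d)
    (hF : ∃ z : ℂ, z.im ≠ 0 ∧ aeval z F = 0) :
    ∀ᶠ c in nhds (0 : ℝ), ∃ z : ℂ, z.im ≠ 0 ∧ aeval z (E * F - C c * G) = 0 := by
  obtain ⟨w, hw, hF⟩ := hF
  have key : ∀ᶠ c in nhds (0 : ℝ), ‖aeval w (E * F - C c * G)‖ < |w.im| ^ d := by
    have hc : ContinuousAt (fun c : ℝ => ‖aeval w (E * F - C c * G)‖) 0 := by
      simp only [map_sub, map_mul, aeval_C, Complex.coe_algebraMap]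
      fun_prop
    refine hc.eventually_lt_const ?_
    have : 0 < |w.im| ^ d := pow_pos (abs_pos.2 hw) d
    simpa [hF] using this
  filter_upwards [key] with c hc
  simp only [← eval_map_algebraMap] at hc ⊢
  refine exists_nonreal_root_of_norm_eval_lt (w := w) ((hm c).1.map _) ?_
  rwa [(hm c).1.natDegree_map, (hm c).2]

lemma exists_sign_eq_of_eventually {p : ℝ → Prop} (h : ∀ᶠ c in nhds (0 : ℝ), p c) {σ : SignType}
    (hσ : σ ≠ 0) : ∃ c, SignType.sign c = σ ∧ p c := by
  obtain ⟨ε, hε, h⟩ := Metric.eventually_nhds_iff.1 h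
  cases σ with
  | zero => exact absurd rfl hσ
  | pos => exact ⟨ε / 2, sign_pos (by positivity), h (by simp [abs_of_pos, hε])⟩
  | neg => exact ⟨-(ε / 2), sign_neg (by linarith), h (by simp [abs_of_pos, hε])⟩

lemma mul_pos_of_sign_eq {x y : ℝ} {σ : SignType} (hσ : σ ≠ 0) (hx : SignType.sign x = σ)
    (hy : SignType.sign y = σ) : 0 < x * y := by
  rw [← sign_eq_one_iff, sign_mul, hx, hy]
  cases σ <;> first | rfl | exact absurd rfl hσ

lemma Contrast.exists_sub {F₁ F₂ : ℝ[X]} {m : ℕ} (h : Contrast F₁ F₂ m) {σ : SignType}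
    (hσ : σ ≠ 0) (G₁ G₂ : ℝ[X]) {d : ℕ}
    (hm : ∀ c, (1 * F₁ - C c * G₁).Monic ∧ (1 * F₁ - C c * G₁).natDegree = d) :
    ∃ c₁ c₂, SignType.sign c₁ = σ ∧ SignType.sign c₂ = σ ∧
      Contrast (1 * F₁ - C c₁ * G₁) (1 * F₂ - C c₂ * G₂) m := by
  obtain ⟨hz, h₀, M, N, hMN, hM, hN⟩ := h
  have hz' := eventually_exists_nonreal_root hm hz
  simp only [one_mul] at hz' ⊢
  have hsign : ∀ F G : ℝ[X], F.eval 0 ≠ 0 →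
      ∀ᶠ c in nhds (0 : ℝ), 0 < (F - C c * G).eval 0 * F.eval 0 := fun F G hF => by
    simpa using eventually_pos_of_sub_mul (v := G.eval 0) (mul_self_pos.2 hF)
  have hF₁ : F₁.eval 0 ≠ 0 := left_ne_zero_of_mul h₀.ne'
  have hF₂ : F₂.eval 0 ≠ 0 := right_ne_zero_of_mul h₀.ne'
  obtain ⟨c₁, hc₁, ⟨hr, ha₁⟩, hs₁⟩ := exists_sign_eq_of_eventually
    ((hz'.and (hM.eventually_sub G₁)).and (hsign F₁ G₁ hF₁)) hσ
  obtain ⟨c₂, hc₂, ha₂, hs₂⟩ := exists_sign_eq_of_eventually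
    ((hN.eventually_sub (G₂.comp (-X))).and (hsign F₂ G₂ hF₂)) hσ
  refine ⟨c₁, c₂, hc₁, hc₂, hr, ?_, M, N, hMN, ha₁, by simpa using ha₂⟩
  refine pos_of_mul_pos_left (b := F₁.eval 0 * F₂.eval 0) ?_ h₀.le
  nlinarith [mul_pos hs₁ hs₂]

lemma Contrast.exists_X_mul_sub {F₁ F₂ : ℝ[X]} {m : ℕ} (h : Contrast F₁ F₂ m) {σ : SignType}
    (hσ : σ ≠ 0) {G₁ G₂ : ℝ[X]} (hG : 0 < G₁.eval 0 * G₂.eval 0) {d : ℕ}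
    (hm : ∀ c, (X * F₁ - C c * G₁).Monic ∧ (X * F₁ - C c * G₁).natDegree = d) :
    ∃ c₁ c₂, SignType.sign c₁ = σ ∧ SignType.sign c₂ = σ ∧
      Contrast (X * F₁ - C c₁ * G₁) (X * F₂ - C c₂ * G₂) (m + 1) := by
  obtain ⟨hz, h₀, M, N, rfl, hM, hN⟩ := h
  have hneg : Filter.Tendsto (fun c : ℝ => -c) (nhds 0) (nhds 0) := by
    simpa using (continuous_neg (G := ℝ)).tendsto 0
  obtain ⟨c₁, hc₁, ⟨hr, hu₁⟩, hs₁⟩ := exists_sign_eq_of_eventually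
    (((eventually_exists_nonreal_root hm hz).and (hM.eventually_X_mul_sub_succ G₁)).and
      (hM.eventually_X_mul_sub G₁)) hσ
  obtain ⟨c₂, hc₂, hu₂, hs₂⟩ := exists_sign_eq_of_eventually
    ((hneg.eventually (hN.eventually_X_mul_sub_succ (G₂.comp (-X)))).and
      (hneg.eventually (hN.eventually_X_mul_sub (G₂.comp (-X))))) hσ
  have hcomp : (X * F₂ - C c₂ * G₂).comp (-X) =
      -(X * F₂.comp (-X) - C (-c₂) * G₂.comp (-X)) := by
    simp
    ring
  have hc := mul_pos_of_sign_eq hσ hc₁ hc₂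
  simp only [eval_comp, eval_neg, eval_X, neg_zero] at hu₂ hs₂
  have hprod : 0 < (c₁ * G₁.eval 0 * F₁.eval 0) * (c₂ * G₂.eval 0 * F₂.eval 0) := by
    nlinarith [mul_pos (mul_pos hc hG) h₀]
  refine ⟨c₁, c₂, hc₁, hc₂, hr, ?_, ?_⟩
  · simp only [eval_sub, eval_mul, eval_X, eval_C]
    nlinarith [mul_pos hc hG]
  · rw [hcomp]
    rcases mul_pos_iff.1 hprod with ⟨h₁, h₂⟩ | ⟨h₁, h₂⟩
    · exact ⟨M + 1, N, by ring, hu₁ h₁, (hs₂ (by linarith)).neg⟩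
    · exact ⟨M, N + 1, by ring, hs₁ h₁, (hu₂ (by linarith)).neg⟩

lemma Contrast.exists_extension {F₁ F₂ G₁ G₂ : ℝ[X]} {k : ℕ} (h : Contrast F₁ F₂ ((k + 1) / 2))
    {σ : SignType} (hσ : σ ≠ 0) (hG : Even k → 0 < G₁.eval 0 * G₂.eval 0) {d : ℕ}
    (hm : ∀ c, ((if Even k then X else 1) * F₁ - C c * G₁).Monic ∧
      ((if Even k then X else 1) * F₁ - C c * G₁).natDegree = d) :
    ∃ c₁ c₂, SignType.sign c₁ = σ ∧ SignType.sign c₂ = σ ∧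
      Contrast ((if Even k then X else 1) * F₁ - C c₁ * G₁)
        ((if Even k then X else 1) * F₂ - C c₂ * G₂) ((k + 2) / 2) := by
  by_cases hk : Even k
  · simp only [if_pos hk] at hm ⊢
    have := h.exists_X_mul_sub hσ (hG hk) hm
    rwa [show (k + 1) / 2 + 1 = (k + 2) / 2 by obtain ⟨r, rfl⟩ := hk; lia] at this
  · simp only [if_neg hk] at hm ⊢
    have := h.exists_sub hσ G₁ G₂ hm
    rwa [show (k + 1) / 2 = (k + 2) / 2 by
      obtain ⟨r, rfl⟩ := Nat.not_even_iff_odd.1 hk; lia] at this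

end Contrast

section PathContrast

/-- Some two choices of edge products with signs `s` have contrasting polynomials on the indices
`a, …, a + k - 1`. -/
def PathContrast (s : ℕ → SignType) (a k : ℕ) : Prop :=
  ∃ c₁ c₂ : ℕ → ℝ, (∀ j, SignType.sign (c₁ j) = s j) ∧ (∀ j, SignType.sign (c₂ j) = s j) ∧
    Contrast (pathPoly c₁ a k) (pathPoly c₂ a k) (k / 2)

variable {s : ℕ → SignType} {a k : ℕ}

lemma sign_update_eq {c : ℕ → ℝ} (hc : ∀ j, SignType.sign (c j) = s j) {i : ℕ} {x : ℝ}
    (hx : SignType.sign x = s i) (j : ℕ) : SignType.sign (Function.update c i x j) = s j := by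
  rcases eq_or_ne j i with rfl | h
  · simpa using hx
  · simpa [h] using hc j

lemma PathContrast.succ_right (hs : ∀ j, s j ≠ 0) (h : PathContrast s a (k + 1)) :
    PathContrast s a (k + 2) := by
  obtain ⟨c₁, c₂, hc₁, hc₂, h⟩ := h
  have hupdate : ∀ (c : ℕ → ℝ) (x : ℝ), pathPoly (Function.update c (a + k) x) a (k + 2) =
      (if Even k then X else 1) * pathPoly c a (k + 1) - C x * pathPoly c a k := by
    intro c x
    rw [pathPoly_add_two, Function.update_self,
      pathPoly_congr (k + 1) fun j _ hj => Function.update_of_ne (by lia) x c,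
      pathPoly_congr k fun j _ hj => Function.update_of_ne (by lia) x c]
  obtain ⟨x₁, x₂, hx₁, hx₂, hx⟩ := h.exists_extension (hs (a + k))
    (G₁ := pathPoly c₁ a k) (G₂ := pathPoly c₂ a k) (d := (k + 2) / 2)
    (fun hk => by
      obtain ⟨m, rfl⟩ := even_iff_exists_two_mul.1 hk
      exact pathPoly_eval_zero_mul_pos (fun j => mul_pos_of_sign_eq (hs j) (hc₁ j) (hc₂ j)) a m)
    (fun c => hupdate c₁ c ▸ pathPoly_monic_natDegree _ _ _)
  refine ⟨_, _, sign_update_eq hc₁ hx₁, sign_update_eq hc₂ hx₂, ?_⟩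
  rwa [hupdate, hupdate]

lemma PathContrast.succ_left (hs : ∀ j, s j ≠ 0) (h : PathContrast s (a + 1) (k + 1)) :
    PathContrast s a (k + 2) := by
  obtain ⟨c₁, c₂, hc₁, hc₂, h⟩ := h
  have hupdate : ∀ (c : ℕ → ℝ) (x : ℝ), pathPoly (Function.update c a x) a (k + 2) =
      (if Even k then X else 1) * pathPoly c (a + 1) (k + 1) - C x * pathPoly c (a + 2) k := by
    intro c x
    rw [pathPoly_add_two_left, Function.update_self,
      pathPoly_congr (k + 1) fun j hj _ => Function.update_of_ne (by lia) x c,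
      pathPoly_congr k fun j hj _ => Function.update_of_ne (by lia) x c]
  obtain ⟨x₁, x₂, hx₁, hx₂, hx⟩ := h.exists_extension (hs a)
    (G₁ := pathPoly c₁ (a + 2) k) (G₂ := pathPoly c₂ (a + 2) k) (d := (k + 2) / 2)
    (fun hk => by
      obtain ⟨m, rfl⟩ := even_iff_exists_two_mul.1 hk
      exact pathPoly_eval_zero_mul_pos
        (fun j => mul_pos_of_sign_eq (hs j) (hc₁ j) (hc₂ j)) (a + 2) m)
    (fun c => hupdate c₁ c ▸ pathPoly_monic_natDegree _ _ _)
  refine ⟨_, _, sign_update_eq hc₁ hx₁, sign_update_eq hc₂ hx₂, ?_⟩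
  rwa [hupdate, hupdate]

lemma PathContrast.add_right (hs : ∀ j, s j ≠ 0) (h : PathContrast s a (k + 1)) (r : ℕ) :
    PathContrast s a (k + 1 + r) := by
  induction r with
  | zero => exact h
  | succ r ih =>
    rw [show k + 1 + r = k + r + 1 by ring] at ih
    rw [show k + 1 + (r + 1) = k + r + 2 by ring]
    exact ih.succ_right hs

lemma PathContrast.add_left (hs : ∀ j, s j ≠ 0) (h : PathContrast s a (k + 1)) :
    PathContrast s 0 (k + 1 + a) := by
  induction a generalizing k with
  | zero => exact h
  | succ a ih =>
    rw [show k + 1 + (a + 1) = k + 1 + 1 + a by ring]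
    exact ih (h.succ_left hs)

lemma contrast_quadratic {F₁ F₂ : ℝ[X]} {p q : ℝ} (hF₁ : F₁ = X ^ 2 + 1)
    (hF₂ : F₂ = X ^ 2 + C p * X + C q) (hq : 0 < q) (h₂ : 4 - 2 * p + q < 0)
    (h₄ : 0 < 16 - 4 * p + q) : Contrast F₁ F₂ 2 := by
  subst hF₁ hF₂
  refine ⟨⟨Complex.I, by simp, by simp⟩, by simpa using hq, 0, 2, rfl,
    ⟨fun j => j, by simp, Nat.strictMono_cast, fun j hj => ?_⟩,
    ⟨fun j => 2 * j, by simp, fun i j hij => by simpa using hij, fun j hj => ?_⟩⟩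
  · obtain rfl : j = 0 := by lia
    simp
  · interval_cases j
    · simp [hq]
    · simp
      nlinarith
    · simp
      nlinarith

lemma pathPoly_four (c : ℕ → ℝ) (a : ℕ) :
    pathPoly c a 4 =
      X ^ 2 - C (c a + c (a + 1) + c (a + 2)) * X + C (c a * c (a + 2)) := by
  simp [pathPoly, show ¬ Even 1 by decide]
  ring

lemma pathContrast_four {l : ℕ}
    (h : (s l, s (l + 1), s (l + 2)) = (SignType.pos, SignType.neg, SignType.pos) ∨
      (s l, s (l + 1), s (l + 2)) = (SignType.neg, SignType.pos, SignType.neg)) :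
    PathContrast s l 4 := by
  let e (x y z : ℝ) : ℕ → ℝ := fun j =>
    if j = l then x else if j = l + 1 then y else if j = l + 2 then z else (s j : ℝ)
  have he₀ (x y z) : e x y z l = x := by simp [e]
  have he₁ (x y z) : e x y z (l + 1) = y := by simp [e]
  have he₂ (x y z) : e x y z (l + 2) = z := by simp [e]
  have hsign {x y z : ℝ} (hx : SignType.sign x = s l) (hy : SignType.sign y = s (l + 1))
      (hz : SignType.sign z = s (l + 2)) (j : ℕ) : SignType.sign (e x y z j) = s j := by
    simp only [e]
    split_ifs with h₀ h₁ h₂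
    · rw [h₀, hx]
    · rw [h₁, hy]
    · rw [h₂, hz]
    · cases s j <;> simp
  simp only [Prod.mk.injEq] at h
  rcases h with ⟨h₀, h₁, h₂⟩ | ⟨h₀, h₁, h₂⟩
  · refine ⟨e 1 (-2) 1, e 1 (-5) 1, hsign ?_ ?_ ?_, hsign ?_ ?_ ?_,
      contrast_quadratic (p := 3) (q := 1) ?_ ?_ ?_ ?_ ?_⟩
    all_goals
      norm_num [pathPoly_four, he₀, he₁, he₂, h₀, h₁, h₂, SignType.pos_eq_one,
        SignType.neg_eq_neg_one]
  · refine ⟨e (-1) 2 (-1), e (-1) 1 (-5), hsign ?_ ?_ ?_, hsign ?_ ?_ ?_,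
      contrast_quadratic (p := 5) (q := 5) ?_ ?_ ?_ ?_ ?_⟩
    all_goals
      norm_num [pathPoly_four, he₀, he₁, he₂, h₀, h₁, h₂, SignType.pos_eq_one,
        SignType.neg_eq_neg_one]

end PathContrast

section Inertia

lemma exists_finset_sq_mem (Y : Finset ℂ) (hY : (0 : ℂ) ∉ Y) :
    ∃ S : Finset ℂ, S.card = 2 * Y.card ∧ ∀ z ∈ S, z ^ 2 ∈ Y := by
  have hsq : ∀ y : ℂ, (y ^ (2 : ℂ)⁻¹) ^ 2 = y := fun y =>
    Complex.cpow_nat_inv_pow y two_ne_zero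
  have hinj : Function.Injective fun y : ℂ => y ^ (2 : ℂ)⁻¹ := fun y y' h => by
    rw [← hsq y, ← hsq y']
    exact congrArg (· ^ 2) h
  have hinj' : Function.Injective fun y : ℂ => -y ^ (2 : ℂ)⁻¹ := neg_injective.comp hinj
  refine ⟨Y.image (fun y => y ^ (2 : ℂ)⁻¹) ∪ Y.image (fun y => -y ^ (2 : ℂ)⁻¹), ?_, ?_⟩
  · rw [Finset.card_union_of_disjoint, Finset.card_image_of_injective _ hinj,
      Finset.card_image_of_injective _ hinj', two_mul]
    rw [Finset.disjoint_left]
    simp only [Finset.mem_image, not_exists, not_and]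
    rintro _ ⟨y, hy, rfl⟩ y' - h
    have h₁ : y' = y := by rw [← hsq y, ← hsq y', ← h, neg_sq]
    rw [h₁, neg_eq_iff_add_eq_zero, ← two_mul] at h
    have h₂ := hsq y
    rw [(mul_eq_zero.1 h).resolve_left two_ne_zero] at h₂
    exact hY (by simpa [← h₂] using hy)
  · simp only [Finset.mem_union, Finset.mem_image]
    rintro z (⟨y, hy, rfl⟩ | ⟨y, hy, rfl⟩)
    · rwa [hsq]
    · rwa [neg_sq, hsq]

variable {n : ℕ} {B : Matrix (Fin n) (Fin n) ℝ} {F : ℝ[X]}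

lemma card_charRoots (B : Matrix (Fin n) (Fin n) ℝ) : (charRoots B).card = n := by
  rw [charRoots, ← (IsAlgClosed.splits _).natDegree_eq_card_roots,
    B.charpoly_monic.natDegree_map, B.charpoly_natDegree_eq_dim, Fintype.card_fin]

lemma two_mul_card_le_card_filter_charRoots
    (hB : B.charpoly = X ^ (n % 2) * F.comp (X ^ 2)) (Y : Finset ℂ) (hY : (0 : ℂ) ∉ Y)
    (hF : ∀ y ∈ Y, aeval y F = 0) (p : ℂ → Prop) [DecidablePred p]
    (hp : ∀ z : ℂ, z ^ 2 ∈ Y → p z) :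
    2 * Y.card ≤ ((charRoots B).filter p).card := by
  obtain ⟨S, hS, hSY⟩ := exists_finset_sq_mem Y hY
  rw [← hS, ← Finset.card_val]
  refine Multiset.card_le_card ((Multiset.le_iff_subset S.nodup).2 fun z hz => ?_)
  refine Multiset.mem_filter.2 ⟨?_, hp z (hSY z hz)⟩
  rw [charRoots, mem_roots (B.charpoly_monic.map _).ne_zero, IsRoot.def, eval_map_algebraMap, hB]
  simp [aeval_comp, hF _ (hSY z hz)]

lemma re_ne_zero_of_sq_eq {z y : ℂ} (h : z ^ 2 = y) (hy : y.im ≠ 0 ∨ 0 < y.re) : z.re ≠ 0 := by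
  intro hz
  have h₁ := congrArg Complex.re h
  have h₂ := congrArg Complex.im h
  simp only [sq, Complex.mul_re, Complex.mul_im, hz, zero_mul, mul_zero, zero_sub, add_zero]
    at h₁ h₂
  rcases hy with hy | hy
  · exact hy h₂.symm
  · nlinarith [mul_self_nonneg z.im]

lemma re_eq_zero_of_sq_eq {z y : ℂ} (h : z ^ 2 = y) (him : y.im = 0) (hre : y.re < 0) :
    z.re = 0 := by
  have h₁ := congrArg Complex.re h
  have h₂ := congrArg Complex.im h
  simp only [sq, Complex.mul_re, Complex.mul_im, him] at h₁ h₂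
  by_contra hz
  have h₃ : z.im = 0 := (mul_eq_zero.1 (show z.re * z.im = 0 by linarith)).resolve_left hz
  rw [h₃] at h₁
  nlinarith [mul_self_nonneg z.re]

lemma inertia_ne_of_contrast {B₁ B₂ : Matrix (Fin n) (Fin n) ℝ} {F₁ F₂ : ℝ[X]}
    (h₁ : B₁.charpoly = X ^ (n % 2) * F₁.comp (X ^ 2))
    (h₂ : B₂.charpoly = X ^ (n % 2) * F₂.comp (X ^ 2)) (h : Contrast F₁ F₂ (n / 2)) :
    inertia B₁ ≠ inertia B₂ := by
  obtain ⟨⟨w, hw, hwF⟩, -, M, N, hMN, hM, hN⟩ := h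
  obtain ⟨r, hr, hr₀⟩ := hM.exists_roots
  obtain ⟨t, ht, ht₀⟩ := hN.exists_roots
  have hcast (F : ℝ[X]) (x : ℝ) (hx : F.eval x = 0) : aeval (x : ℂ) F = 0 := by
    rw [← Complex.coe_algebraMap, aeval_algebraMap_apply, coe_aeval_eq_eval, hx, map_zero]
  let Y₁ : Finset ℂ := insert w (Finset.univ.image (Complex.ofReal ∘ r))
  let Y₂ : Finset ℂ := Finset.univ.image (Complex.ofReal ∘ Neg.neg ∘ t)
  have hY₁ : ∀ y ∈ Y₁, (y.im ≠ 0 ∨ 0 < y.re) ∧ aeval y F₁ = 0 := by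
    intro y hy
    simp only [Y₁, Finset.mem_insert, Finset.mem_image, Finset.mem_univ, true_and] at hy
    rcases hy with rfl | ⟨i, rfl⟩
    · exact ⟨Or.inl hw, hwF⟩
    · exact ⟨Or.inr (by simpa using (hr₀ i).1), hcast _ _ (hr₀ i).2⟩
  have hY₂ : ∀ y ∈ Y₂, y.im = 0 ∧ y.re < 0 ∧ aeval y F₂ = 0 := by
    intro y hy
    simp only [Y₂, Finset.mem_image, Finset.mem_univ, true_and] at hy
    obtain ⟨i, rfl⟩ := hy
    exact ⟨Complex.ofReal_im _, by simpa using (ht₀ i).1,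
      hcast _ _ (by simpa [eval_comp] using (ht₀ i).2)⟩
  have hcard₁ : Y₁.card = M + 1 := by
    rw [Finset.card_insert_of_notMem, Finset.card_image_of_injective _
      (Complex.ofReal_injective.comp hr), Finset.card_univ, Fintype.card_fin]
    simp only [Finset.mem_image, not_exists, not_and]
    rintro i - rfl
    exact hw (Complex.ofReal_im _)
  have hcard₂ : Y₂.card = N := by
    rw [Finset.card_image_of_injective _
      (Complex.ofReal_injective.comp (neg_injective.comp ht)), Finset.card_univ, Fintype.card_fin]
  have hle₁ := two_mul_card_le_card_filter_charRoots h₁ Y₁ (fun h => by simpa using (hY₁ 0 h).1)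
    (fun y hy => (hY₁ y hy).2) (fun z => ¬ z.re = 0)
    (fun z hz => re_ne_zero_of_sq_eq rfl (hY₁ _ hz).1)
  have hle₂ := two_mul_card_le_card_filter_charRoots h₂ Y₂ (fun h => by simpa using (hY₂ 0 h).2.1)
    (fun y hy => (hY₂ y hy).2.2) (fun z => z.re = 0)
    (fun z hz => re_eq_zero_of_sq_eq rfl (hY₂ _ hz).1 (hY₂ _ hz).2.1)
  have htotal := congrArg Multiset.card
    (Multiset.filter_add_not (fun z : ℂ => z.re = 0) (charRoots B₁))
  rw [Multiset.card_add, card_charRoots] at htotal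
  intro heq
  have h₀ : ((charRoots B₁).filter (fun z => z.re = 0)).card =
      ((charRoots B₂).filter (fun z => z.re = 0)).card := congrArg (fun x => x.2.2) heq
  lia

end Inertia

section Realization

variable {n : ℕ} {P : Matrix (Fin n) (Fin n) SignType}

lemma exists_qClass_charpoly_eq
    (htri : ∀ i j : Fin n, P i j ≠ 0 ↔ ((i : ℕ) + 1 = j ∨ (j : ℕ) + 1 = i)) (c : ℕ → ℝ)
    (hc : ∀ k : ℕ, (hk : k + 1 < n) → SignType.sign (c k) =
      P ⟨k, Nat.lt_of_succ_lt hk⟩ ⟨k + 1, hk⟩ * P ⟨k + 1, hk⟩ ⟨k, Nat.lt_of_succ_lt hk⟩) :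
    ∃ B, QClass P B ∧ B.charpoly = X ^ (n % 2) * (pathPoly c 0 n).comp (X ^ 2) := by
  let u : ℕ → ℝ := fun k =>
    if hk : k + 1 < n then (P ⟨k, Nat.lt_of_succ_lt hk⟩ ⟨k + 1, hk⟩ : ℝ) else 1
  have hu : ∀ k, u k * u k = 1 := by
    intro k
    simp only [u]
    split_ifs with hk
    · have := (htri ⟨k, Nat.lt_of_succ_lt hk⟩ ⟨k + 1, hk⟩).2 (Or.inl rfl)
      generalize P ⟨k, Nat.lt_of_succ_lt hk⟩ ⟨k + 1, hk⟩ = σ at this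
      cases σ <;> simp at this ⊢
    · simp
  let b : ℕ → ℕ → ℝ := fun i j => if i + 1 = j then u i else if j + 1 = i then u j * c j else 0
  refine ⟨Matrix.of fun i j : Fin n => b i j, ?_, charpoly_tridiagonal_eq_pathPoly b c ?_ ?_ n⟩
  · rintro ⟨i, hi⟩ ⟨j, hj⟩
    have hsign : ∀ k (hk : k + 1 < n),
        SignType.sign (u k) = P ⟨k, Nat.lt_of_succ_lt hk⟩ ⟨k + 1, hk⟩ := by
      intro k hk
      simp only [u, dif_pos hk]
      cases P ⟨k, Nat.lt_of_succ_lt hk⟩ ⟨k + 1, hk⟩ <;> simp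
    simp only [of_apply, b]
    split_ifs with h₁ h₂
    · subst h₁
      exact hsign i hj
    · subst h₂
      rw [sign_mul, hc j hi, ← hsign j hi, ← mul_assoc, ← sign_mul, hu, sign_one, one_mul]
    · rw [sign_zero, eq_comm, ← not_ne_iff, htri]
      exact not_or.2 ⟨h₁, h₂⟩
  · intro i j h
    rw [not_or] at h
    simp [b, h]
  · intro i
    simp only [b, if_true, if_neg (show ¬ i + 1 + 1 = i by lia)]
    rw [← mul_assoc, hu, one_mul]

end Realization

/-- An irreducible tridiagonal sign pattern with `0`-diagonal containing `P₄` (consecutive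
edge signs `+,−,+`) or its negation `P₄₋` (edge signs `−,+,−`) as a principal subpattern
on four consecutive indices does not require a unique inertia. -/
theorem tridiagonal_P4_subpattern_not_unique_inertia (n : ℕ) (hn : 4 ≤ n)
    (P : Matrix (Fin n) (Fin n) SignType)
    (htri : ∀ i j : Fin n, P i j ≠ 0 ↔ ((i : ℕ) + 1 = j ∨ (j : ℕ) + 1 = i))
    (s : ℕ → SignType)
    (hs : ∀ k : ℕ, (hk : k + 1 < n) →
      s k = P ⟨k, Nat.lt_of_succ_lt hk⟩ ⟨k + 1, hk⟩ * P ⟨k + 1, hk⟩ ⟨k, Nat.lt_of_succ_lt hk⟩)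
    (hsub : ∃ l : ℕ, l + 2 ≤ n - 2 ∧
      ((s l, s (l + 1), s (l + 2)) = (SignType.pos, SignType.neg, SignType.pos) ∨
        (s l, s (l + 1), s (l + 2)) = (SignType.neg, SignType.pos, SignType.neg))) :
    ∃ B₁ B₂, QClass P B₁ ∧ QClass P B₂ ∧ inertia B₁ ≠ inertia B₂ := by
  obtain ⟨l, hl, hsub⟩ := hsub
  let s' : ℕ → SignType := fun k => if k + 1 < n then s k else 1
  have hs' : ∀ k, k + 1 < n → s' k = s k := fun k hk => if_pos hk
  have hs₀ : ∀ k, s' k ≠ 0 := by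
    intro k
    by_cases hk : k + 1 < n
    · rw [hs' k hk, hs k hk]
      exact mul_ne_zero ((htri _ _).2 (Or.inl rfl)) ((htri _ _).2 (Or.inr rfl))
    · simp [s', hk]
  rw [← hs' l (by lia), ← hs' (l + 1) (by lia), ← hs' (l + 2) (by lia)] at hsub
  have h := (pathContrast_four hsub).add_right hs₀ (n - 4 - l)
  rw [show 3 + 1 + (n - 4 - l) = 3 + (n - 4 - l) + 1 by ring] at h
  have h := h.add_left hs₀
  rw [show 3 + (n - 4 - l) + 1 + l = n by lia] at h
  obtain ⟨c₁, c₂, hc₁, hc₂, h⟩ := h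
  obtain ⟨B₁, hQ₁, hB₁⟩ := exists_qClass_charpoly_eq htri c₁
    fun k hk => by rw [hc₁, hs' k hk, hs k hk]
  obtain ⟨B₂, hQ₂, hB₂⟩ := exists_qClass_charpoly_eq htri c₂
    fun k hk => by rw [hc₂, hs' k hk, hs k hk]
  exact ⟨B₁, B₂, hQ₁, hQ₂, inertia_ne_of_contrast hB₁ hB₂ h⟩
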